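/- arXiv:math/9810177 — 16 statements merged into one kernel-verified Lean document; each statement's English description precedes it below -/
import Mathlib

section
/- A subset A of a topological space X is preopen if and only if there exist an open set U and a dense set D such that A = U ∩ D. -/
/-- A subset `A` of a topological space is preopen iff it is the intersection of
an open set and a dense set. -/
theorem preopen_iff_inter_open_dense {X : Type*} [TopologicalSpace X] (A : Set X) :
    A ⊆ interior (closure A) ↔
      ∃ (U D : Set X), IsOpen U ∧ Dense D ∧ A = U ∩ D := by
  constructor
  · intro hA
    refine ⟨interior (closure A), A ∪ (closure A)ᶜ, isOpen_interior, fun x => ?_, ?_⟩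
    · by_cases hx : x ∈ closure A
      · exact closure_mono Set.subset_union_left hx
      · exact subset_closure (Or.inr hx)
    · ext x
      refine ⟨fun hx => ⟨hA hx, Or.inl hx⟩, ?_⟩
      rintro ⟨hx, hxA | hxA⟩
      · exact hxA
      · exact absurd (interior_subset hx) hxA
  · rintro ⟨U, D, hU, hD, rfl⟩
    exact Set.inter_subset_left.trans
      (interior_maximal (hD.open_subset_closure_inter hU) hU)
end

section
/- A subset A of a topological space X is preopen if and only if there exist a regular open set R and a dense set D such that A = R ∩ D. -/
/-- A subset `A` of a topological space is preopen iff it is the intersection of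
a regular open set and a dense set. -/
theorem preopen_iff_inter_regularOpen_dense {X : Type*} [TopologicalSpace X] (A : Set X) :
    A ⊆ interior (closure A) ↔
      ∃ (R D : Set X), R = interior (closure R) ∧ Dense D ∧ A = R ∩ D := by
  constructor
  · intro h
    refine ⟨interior (closure A), A ∪ (interior (closure A))ᶜ, interior_closure_idem.symm, fun x => ?_, ?_⟩
    · by_cases hx : x ∈ interior (closure A)
      · exact closure_mono Set.subset_union_left (interior_subset hx)
      · exact subset_closure (Or.inr hx)
    · rw [Set.inter_union_distrib_left, Set.inter_compl_self, Set.union_empty,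
        Set.inter_eq_right.mpr h]
  · rintro ⟨R, D, hR, hD, rfl⟩
    have hRo : IsOpen R := hR ▸ isOpen_interior
    exact Set.inter_subset_left.trans
      (interior_maximal (hD.open_subset_closure_inter hRo) hRo)
end

section
/- A subset A of a topological space X is preopen if and only if its semi-closure sCl(A) = A ∪ interior(closure(A)) is a regular open set. -/
/-- A set and its semi-closure have the same closure. -/
theorem closure_union_interior_closure {X : Type*} [TopologicalSpace X] (A : Set X) :
    closure (A ∪ interior (closure A)) = closure A :=
  (closure_minimal (Set.union_subset subset_closure interior_subset) isClosed_closure).antisymm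
    (closure_mono Set.subset_union_left)

/-- A subset `A` of a topological space is preopen iff its semi-closure
`sCl(A) = A ∪ interior (closure A)` is regular open. -/
theorem preopen_iff_semiClosure_regularOpen {X : Type*} [TopologicalSpace X] (A : Set X) :
    A ⊆ interior (closure A) ↔
      A ∪ interior (closure A) =
        interior (closure (A ∪ interior (closure A))) := by
  rw [closure_union_interior_closure, Set.union_eq_right]
end

section
/- A subset A of a topological space X is preopen if and only if there exists a regular open set R containing A such that closure(A) = closure(R). -/
/-- A subset `A` of a topological space is preopen iff there is a regular open set `R`
containing `A` with `closure A = closure R`. -/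
theorem preopen_iff_exists_regularOpen_same_closure {X : Type*} [TopologicalSpace X]
    (A : Set X) :
    A ⊆ interior (closure A) ↔
      ∃ R : Set X, R = interior (closure R) ∧ A ⊆ R ∧ closure A = closure R := by
  constructor
  · intro h
    have hcl : closure A = closure (interior (closure A)) :=
      (closure_mono h).antisymm (closure_minimal interior_subset isClosed_closure)
    exact ⟨interior (closure A), congrArg interior hcl, h, hcl⟩
  · rintro ⟨R, hR, hAR, hcl⟩
    rw [hcl, ← hR]
    exact hAR
end

section
/- (Noiri's Lemma) Let X be a topological space, let A be a semi-open subset of X and let B be a preopen subset of X. Then A ∩ B is semi-open in the subspace B (with the subspace topology) and A ∩ B is preopen in the subspace A (with the subspace topology). -/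
theorem closure_interior_inter_interior_closure_subset {X : Type*} [TopologicalSpace X]
    (A B : Set X) :
    closure (interior A) ∩ interior (closure B) ⊆ closure (interior A ∩ B) :=
  calc closure (interior A) ∩ interior (closure B)
      ⊆ closure (interior A ∩ interior (closure B)) := isOpen_interior.closure_inter
    _ ⊆ closure (interior A ∩ closure B) :=
        closure_mono (Set.inter_subset_inter_right _ interior_subset)
    _ ⊆ closure (interior A ∩ B) :=
        closure_minimal isOpen_interior.inter_closure isClosed_closure

/-- Noiri's Lemma: if `A` is semi-open and `B` is preopen, then `A ∩ B` is semi-open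
in the subspace `B` and preopen in the subspace `A`. -/
theorem noiri_lemma {X : Type*} [TopologicalSpace X] (A B : Set X)
    (hA : A ⊆ closure (interior A)) (hB : B ⊆ interior (closure B)) :
    ((Subtype.val ⁻¹' (A ∩ B) : Set B) ⊆
        closure (interior (Subtype.val ⁻¹' (A ∩ B) : Set B))) ∧
    ((Subtype.val ⁻¹' (A ∩ B) : Set A) ⊆
        interior (closure (Subtype.val ⁻¹' (A ∩ B) : Set A))) := by
  have key := closure_interior_inter_interior_closure_subset A B
  constructor
  · rintro x ⟨hxA, hxB⟩
    have hsub : (Subtype.val ⁻¹' interior A : Set B) ⊆ interior (Subtype.val ⁻¹' (A ∩ B)) :=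
      interior_maximal (fun y hy => ⟨interior_subset hy, y.2⟩)
        (isOpen_interior.preimage continuous_subtype_val)
    refine closure_mono hsub ?_
    rw [Topology.IsInducing.subtypeVal.closure_eq_preimage_closure_image, Set.mem_preimage,
      Subtype.image_preimage_coe, Set.inter_comm]
    exact key ⟨hA hxA, hB hxB⟩
  · rintro x ⟨-, hxB⟩
    refine interior_maximal (s := closure _) (t := Subtype.val ⁻¹' interior (closure B))
      (fun y hy => ?_)
      (isOpen_interior.preimage continuous_subtype_val) (hB hxB)
    rw [Topology.IsInducing.subtypeVal.closure_eq_preimage_closure_image, Set.mem_preimage,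
      Subtype.image_preimage_coe, ← Set.inter_assoc, Set.inter_self]
    exact closure_mono (Set.inter_subset_inter_left _ interior_subset) (key ⟨hA y.2, hy⟩)
end

section
/- (Janković and Reilly's Lemma) In any topological space X, every singleton {x} is either preopen or nowhere dense. -/
/-- Janković and Reilly's Lemma: every singleton is either preopen or nowhere dense. -/
theorem singleton_preopen_or_nowhereDense {X : Type*} [TopologicalSpace X] (x : X) :
    ({x} : Set X) ⊆ interior (closure ({x} : Set X)) ∨
      interior (closure ({x} : Set X)) = ∅ := by
  rcases (interior (closure ({x} : Set X))).eq_empty_or_nonempty with h | ⟨y, hy⟩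
  · exact Or.inr h
  · left
    obtain ⟨z, hz, hzx⟩ := mem_closure_iff.1 (interior_subset hy) _ isOpen_interior hy
    rw [Set.mem_singleton_iff] at hzx
    exact Set.singleton_subset_iff.2 (hzx ▸ hz)
end

section
/- In any topological space X, if P is a preopen set and A is an α-open set, then P ∩ A is preopen. -/
/-- The intersection of a preopen set and an α-open set is preopen. -/
theorem preopen_inter_alphaOpen {X : Type*} [TopologicalSpace X] (P A : Set X)
    (hP : P ⊆ interior (closure P)) (hA : A ⊆ interior (closure (interior A))) :
    P ∩ A ⊆ interior (closure (P ∩ A)) := by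
  refine (Set.inter_subset_inter hP hA).trans
    (interior_maximal ?_ (isOpen_interior.inter isOpen_interior))
  calc interior (closure P) ∩ interior (closure (interior A))
      ⊆ interior (closure P) ∩ closure (interior A) :=
        Set.inter_subset_inter_right _ interior_subset
    _ ⊆ closure (interior (closure P) ∩ interior A) := isOpen_interior.inter_closure
    _ ⊆ closure (closure P ∩ interior A) :=
        closure_mono (Set.inter_subset_inter_left _ interior_subset)
    _ ⊆ closure (P ∩ interior A) :=
        closure_minimal isOpen_interior.closure_inter isClosed_closure
    _ ⊆ closure (P ∩ A) := closure_mono (Set.inter_subset_inter_right _ interior_subset)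
end

section
/- A subset A of a topological space X is α-open if and only if A is both semi-open and preopen. -/
/-- A set is α-open iff it is both semi-open and preopen. -/
theorem alphaOpen_iff_semiOpen_and_preopen {X : Type*} [TopologicalSpace X] (A : Set X) :
    A ⊆ interior (closure (interior A)) ↔
      A ⊆ closure (interior A) ∧ A ⊆ interior (closure A) := by
  constructor
  · intro h
    exact ⟨h.trans interior_subset,
      h.trans (interior_mono (closure_mono interior_subset))⟩
  · rintro ⟨hsemi, hpre⟩
    exact hpre.trans (interior_mono (closure_minimal hsemi isClosed_closure))
end

section
/- Let X be a topological space, let U be a preopen subset of X, and let V ⊆ U be preopen in the subspace U (with the subspace topology). Then V is preopen in X. -/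
/-- If `U` is preopen in `X` and `V ⊆ U` is preopen in the subspace `U`,
then `V` is preopen in `X`. -/
theorem preopen_of_preopen_in_preopen {X : Type*} [TopologicalSpace X] (U V : Set X)
    (hVU : V ⊆ U) (hU : U ⊆ interior (closure U))
    (hV : (Subtype.val ⁻¹' V : Set U) ⊆ interior (closure (Subtype.val ⁻¹' V : Set U))) :
    V ⊆ interior (closure V) := by
  intro x hx
  obtain ⟨O, hO, hO_eq⟩ := isOpen_induced_iff.mp
    (isOpen_interior (s := closure (Subtype.val ⁻¹' V : Set U)))
  have hxO : x ∈ O := by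
    have h := hV (show (⟨x, hVU hx⟩ : U) ∈ Subtype.val ⁻¹' V from hx)
    rwa [← hO_eq] at h
  have hOU : O ∩ U ⊆ closure V := by
    rintro y ⟨hyO, hyU⟩
    have h : (⟨y, hyU⟩ : U) ∈ interior (closure (Subtype.val ⁻¹' V : Set U)) := by
      rw [← hO_eq]
      exact hyO
    exact continuous_subtype_val.closure_preimage_subset V (interior_subset h)
  refine mem_interior.mpr
    ⟨O ∩ interior (closure U), ?_, hO.inter isOpen_interior, hxO, hU (hVU hx)⟩
  exact (Set.inter_subset_inter_right O interior_subset).trans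
    (hO.inter_closure.trans (closure_minimal hOU isClosed_closure))
end

section
/- Let X be a topological space and let U, V be subsets with U ⊆ V ⊆ closure(U). If V is preopen, then U is preopen. -/
/-- If `V` is preopen and `U ⊆ V ⊆ closure U`, then `U` is preopen. -/
theorem preopen_of_between {X : Type*} [TopologicalSpace X] (U V : Set X)
    (hUV : U ⊆ V) (hVclU : V ⊆ closure U) (hV : V ⊆ interior (closure V)) :
    U ⊆ interior (closure U) := by
  exact (hUV.trans hV).trans (interior_mono (closure_minimal hVclU isClosed_closure))
end

section
/- If A is a preopen subset of a topological space X, then the closure of A equals the θ-closure of A, i.e., closure(A) = {x ∈ X : for every open set U containing x, closure(U) ∩ A ≠ ∅}. -/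
/-- If `A` is preopen, then the closure of `A` equals the θ-closure of `A`. -/
theorem closure_eq_thetaClosure_of_preopen {X : Type*} [TopologicalSpace X] (A : Set X)
    (hA : A ⊆ interior (closure A)) :
    closure A = {x : X | ∀ U : Set X, IsOpen U → x ∈ U → (closure U ∩ A).Nonempty} := by
  ext x
  rw [mem_closure_iff, Set.mem_ofPred_eq]
  refine forall₃_congr fun U hU _ =>
    ⟨fun h => h.mono (Set.inter_subset_inter_left A subset_closure), ?_⟩
  rintro ⟨y, hyU, hyA⟩
  obtain ⟨z, hz, hzU⟩ := mem_closure_iff.1 hyU _ isOpen_interior (hA hyA)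
  exact mem_closure_iff.1 (interior_subset hz) U hU hzU
end

section
/- Let (X_i)_{i ∈ I} be a family of topological spaces and let A_i be a nonempty subset of X_i for each i ∈ I. Then the product set ∏_{i ∈ I} A_i is preopen in the product space ∏_{i ∈ I} X_i if and only if A_i is preopen in X_i for each i ∈ I and the set of indices i for which A_i is not dense in X_i is finite. -/
/-- If a box `∏ i, B i` is a neighbourhood of `x`, then every factor `B i` is a neighbourhood
of `x i`. -/
theorem mem_nhds_of_univ_pi_mem_nhds {ι : Type*} {X : ι → Type*} [∀ i, TopologicalSpace (X i)]
    {B : ∀ i, Set (X i)} {x : ∀ i, X i} (h : Set.univ.pi B ∈ nhds x) (i : ι) :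
    B i ∈ nhds (x i) := by
  classical
  have hc : ContinuousAt (Function.update x i) (x i) :=
    (continuous_const.update i continuous_id).continuousAt
  have hx : Set.univ.pi B ∈ nhds (Function.update x i (x i)) := by
    rwa [Function.update_eq_self]
  filter_upwards [hc hx] with y hy
  simpa using hy i (Set.mem_univ i)

/-- If a box `∏ i, B i` is a neighbourhood of a point, then all but finitely many of its
factors are the whole space. -/
theorem finite_ne_univ_of_univ_pi_mem_nhds {ι : Type*} {X : ι → Type*}
    [∀ i, TopologicalSpace (X i)] {B : ∀ i, Set (X i)} {x : ∀ i, X i}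
    (h : Set.univ.pi B ∈ nhds x) : {i | B i ≠ Set.univ}.Finite := by
  classical
  obtain ⟨F, u, hu, hF⟩ := isOpen_pi_iff.1 isOpen_interior x (mem_interior_iff_mem_nhds.2 h)
  refine F.finite_toSet.subset fun i hi => ?_
  by_contra hiF
  refine hi (Set.eq_univ_of_forall fun y => ?_)
  have hy : Function.update x i y ∈ (F : Set ι).pi u := fun j hj => by
    rw [Function.update_of_ne (ne_of_mem_of_not_mem hj hiF)]
    exact (hu j hj).2
  simpa using interior_subset (hF hy) i (Set.mem_univ i)

/-- A product `∏ i, A i` of nonempty sets is preopen in the product space iff each `A i`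
is preopen and all but finitely many `A i` are dense. -/
theorem pi_preopen_iff {ι : Type*} {X : ι → Type*} [∀ i, TopologicalSpace (X i)]
    (A : ∀ i, Set (X i)) (hne : ∀ i, (A i).Nonempty) :
    (Set.univ.pi A ⊆ interior (closure (Set.univ.pi A))) ↔
      (∀ i, A i ⊆ interior (closure (A i))) ∧ {i | ¬ Dense (A i)}.Finite := by
  classical
  simp only [dense_iff_closure_eq, closure_pi_set]
  constructor
  · intro h
    choose x hx using hne
    have key : ∀ z ∈ Set.univ.pi A, Set.univ.pi (fun i => closure (A i)) ∈ nhds z :=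
      fun z hz => mem_interior_iff_mem_nhds.1 (h hz)
    refine ⟨fun i a ha => mem_interior_iff_mem_nhds.2 ?_,
      finite_ne_univ_of_univ_pi_mem_nhds (key x fun i _ => hx i)⟩
    have hz : Function.update x i a ∈ Set.univ.pi A :=
      (Set.update_mem_pi_iff_of_mem fun j _ => hx j).2 fun _ => ha
    simpa using mem_nhds_of_univ_pi_mem_nhds (key _ hz) i
  · rintro ⟨h, hfin⟩ x hx
    refine mem_interior_iff_mem_nhds.2 (Filter.mem_of_superset (set_pi_mem_nhds hfin
      fun i _ => mem_interior_iff_mem_nhds.1 (h i (hx i (Set.mem_univ i)))) fun y hy i _ => ?_)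
    by_cases hi : closure (A i) = Set.univ
    · simp [hi]
    · exact hy i hi
end

section
/- For a topological space X the following are equivalent: (1) X is extremally disconnected (the closure of every open set is open); (2) every semi-open subset of X is preopen; (3) the closure of every preopen set is open; (4) the closure of every preopen set is preopen. -/
/-- Characterizations of extremally disconnected spaces in terms of preopen sets. -/
theorem extremallyDisconnected_tfae {X : Type*} [TopologicalSpace X] :
    List.TFAE
      [∀ U : Set X, IsOpen U → IsOpen (closure U),
       ∀ A : Set X, A ⊆ closure (interior A) → A ⊆ interior (closure A),
       ∀ A : Set X, A ⊆ interior (closure A) → IsOpen (closure A),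
       ∀ A : Set X, A ⊆ interior (closure A) →
         closure A ⊆ interior (closure (closure A))] := by
  have isOpen_closure_of_subset {A : Set X} (h : closure A ⊆ interior (closure (closure A))) :
      IsOpen (closure A) := by
    rw [closure_closure] at h
    exact subset_interior_iff_isOpen.mp h
  tfae_have 1 → 2 := fun h A hA =>
    hA.trans (interior_maximal (closure_mono interior_subset) (h _ isOpen_interior))
  tfae_have 2 → 1 := fun h U hU =>
    isOpen_closure_of_subset (h _ (closure_mono (interior_maximal subset_closure hU)))
  tfae_have 1 → 3 := fun h A hA => by
    have hcl : closure A = closure (interior (closure A)) :=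
      (closure_mono hA).antisymm (closure_minimal interior_subset isClosed_closure)
    rw [hcl]
    exact h _ isOpen_interior
  tfae_have 3 → 4 := fun h A hA => interior_maximal subset_closure (h A hA)
  tfae_have 4 → 1 := fun h U hU =>
    isOpen_closure_of_subset (h U (interior_maximal subset_closure hU))
  tfae_finish
end

section
/- A nonempty topological space X is hyperconnected (i.e., every nonempty open subset of X is dense) if and only if every nonempty preopen subset of X is dense. -/
/-- A nonempty space is hyperconnected iff every nonempty preopen subset is dense. -/
theorem hyperconnected_iff_preopen_dense {X : Type*} [TopologicalSpace X] [Nonempty X] :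
    (∀ U : Set X, IsOpen U → U.Nonempty → Dense U) ↔
      (∀ A : Set X, A ⊆ interior (closure A) → A.Nonempty → Dense A) :=
  ⟨fun h _ hA hne =>
    dense_closure.mp ((h _ isOpen_interior (hne.mono hA)).mono interior_subset),
   fun h U hU => h U (hU.subset_interior_iff.mpr subset_closure)⟩
end

section
/- For a topological space X the following are equivalent: (1) X is locally indiscrete (every open subset of X is closed); (2) every subset of X is preopen; (3) every singleton in X is preopen; (4) every closed subset of X is preopen. -/
/-- Characterizations of locally indiscrete spaces in terms of preopen sets. -/
theorem locallyIndiscrete_tfae {X : Type*} [TopologicalSpace X] :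
    List.TFAE
      [∀ U : Set X, IsOpen U → IsClosed U,
       ∀ A : Set X, A ⊆ interior (closure A),
       ∀ x : X, ({x} : Set X) ⊆ interior (closure ({x} : Set X)),
       ∀ A : Set X, IsClosed A → A ⊆ interior (closure A)] := by
  tfae_have 1 → 2 := fun h A => by
    have hA : IsOpen (closure A) := by
      simpa using h (closure A)ᶜ isClosed_closure.isOpen_compl
    rw [hA.interior_eq]
    exact subset_closure
  tfae_have 2 → 3 := fun h x => h {x}
  tfae_have 3 → 2 := fun h A x hx =>
    interior_mono (closure_mono (Set.singleton_subset_iff.2 hx)) (h x rfl)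
  tfae_have 2 → 4 := fun h A _ => h A
  tfae_have 4 → 1 := fun h U hU => by
    have hUc := h Uᶜ hU.isClosed_compl
    rw [hU.isClosed_compl.closure_eq] at hUc
    exact isOpen_compl_iff.1 (subset_interior_iff_isOpen.1 hUc)
  tfae_finish
end

section
/- A topological space X is submaximal (i.e., every dense subset of X is open) if and only if every preopen subset of X is open. -/
theorem dense_union_compl_closure {X : Type*} [TopologicalSpace X] (A : Set X) :
    Dense (A ∪ (closure A)ᶜ) := by
  intro x
  rw [closure_union]
  by_cases hx : x ∈ closure A
  · exact Or.inl hx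
  · exact Or.inr (subset_closure hx)

/-- A space is submaximal iff every preopen set is open. -/
theorem submaximal_iff_preopen_open {X : Type*} [TopologicalSpace X] :
    (∀ D : Set X, Dense D → IsOpen D) ↔
      (∀ A : Set X, A ⊆ interior (closure A) → IsOpen A) := by
  refine ⟨fun h A hA => ?_, fun h D hD => h D (by simp [hD.closure_eq])⟩
  have hA_eq : A = interior (closure A) ∩ (A ∪ (closure A)ᶜ) := by
    refine Set.Subset.antisymm (fun x hx => ⟨hA hx, Or.inl hx⟩) ?_
    rintro x ⟨hx, hxA | hxA⟩
    · exact hxA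
    · exact absurd (interior_subset hx) hxA
  rw [hA_eq]
  exact isOpen_interior.inter (h _ (dense_union_compl_closure A))
end
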